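/- arXiv:hep-th/9703152 — 2 statements merged into one kernel-verified Lean document; each statement's English description precedes it below -/
import Mathlib

section
/- Inversion of the kinetic operator of the gaussian BFYM model (propagator matrix of Appendix A): for every p ∈ ℝ³ with p ≠ 0 and every α ∈ ℝ, the complex 7×7 block matrices, with blocks indexed by the field multiplet (A ∈ ℂ³, B ∈ ℂ³, b ∈ ℂ), K(p) = [[0₃, E(p), i·p],[E(p), I₃, 0],[−i·pᵀ, 0, α]] and Δ(p) = [[P(p)/‖p‖² − α·p pᵀ/‖p‖⁴, −E(p)/‖p‖², i·p/‖p‖²],[−E(p)/‖p‖², p pᵀ/‖p‖², 0],[−i·pᵀ/‖p‖², 0, 0]] satisfy Δ(p)·K(p) = I₇ and K(p)·Δ(p) = I₇. In particular the momentum-space kinetic matrix K(p) of the gauge-fixed first-order lagrangean is invertible for all p ≠ 0, with inverse the BFYM propagator matrix Δ(p). -/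
open Matrix Complex

noncomputable section

/-- The Levi-Civita symbol on `Fin 3`, with `eps 0 1 2 = 1`. -/
def eps (i j k : Fin 3) : ℝ :=
  if (i, j, k) = ((0 : Fin 3), (1 : Fin 3), (2 : Fin 3)) ∨
     (i, j, k) = ((1 : Fin 3), (2 : Fin 3), (0 : Fin 3)) ∨
     (i, j, k) = ((2 : Fin 3), (0 : Fin 3), (1 : Fin 3)) then 1
  else if (i, j, k) = ((2 : Fin 3), (1 : Fin 3), (0 : Fin 3)) ∨
     (i, j, k) = ((1 : Fin 3), (0 : Fin 3), (2 : Fin 3)) ∨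
     (i, j, k) = ((0 : Fin 3), (2 : Fin 3), (1 : Fin 3)) then -1
  else 0

/-- The momentum-space curl matrix `E(p) μ ν = ∑ ρ, ε μ ρ ν * p ρ`, as a complex matrix. -/
def curlE (p : EuclideanSpace ℝ (Fin 3)) : Matrix (Fin 3) (Fin 3) ℂ :=
  Matrix.of fun μ ν => ∑ ρ : Fin 3, (eps μ ρ ν : ℂ) * (p ρ : ℂ)

/-- `‖p‖²` as a complex number. -/
def nsq (p : EuclideanSpace ℝ (Fin 3)) : ℂ := ((‖p‖ : ℝ) : ℂ) ^ 2

/-- The index type of the gaussian BFYM multiplet `(A ∈ ℂ³, B ∈ ℂ³, b ∈ ℂ)`. -/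
abbrev BFYMIdx : Type := Fin 3 ⊕ Fin 3 ⊕ Unit

/-- The momentum-space kinetic matrix `K(p)` of the gauge-fixed gaussian BFYM model,
with blocks `[[0₃, E(p), i·p], [E(p), I₃, 0], [−i·pᵀ, 0, α]]`. -/
def Kgauss (α : ℝ) (p : EuclideanSpace ℝ (Fin 3)) : Matrix BFYMIdx BFYMIdx ℂ :=
  Matrix.of fun i j =>
    match i, j with
    | .inl _, .inl _ => 0  -- 0 block (A,A)
    | .inl μ, .inr (.inl ν) => curlE p μ ν
    | .inl μ, .inr (.inr _) => Complex.I * (p μ : ℂ)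
    | .inr (.inl μ), .inl ν => curlE p μ ν
    | .inr (.inl μ), .inr (.inl ν) => if μ = ν then 1 else 0
    | .inr (.inl _), .inr (.inr _) => 0
    | .inr (.inr _), .inl ν => -Complex.I * (p ν : ℂ)
    | .inr (.inr _), .inr (.inl _) => 0
    | .inr (.inr _), .inr (.inr _) => (α : ℂ)

/-- The BFYM propagator matrix `Δ(p)`, with blocks
`[[P(p)/‖p‖² − α·p pᵀ/‖p‖⁴, −E(p)/‖p‖², i·p/‖p‖²], [−E(p)/‖p‖², p pᵀ/‖p‖², 0],
  [−i·pᵀ/‖p‖², 0, 0]]`. -/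
def DeltaGauss (α : ℝ) (p : EuclideanSpace ℝ (Fin 3)) : Matrix BFYMIdx BFYMIdx ℂ :=
  Matrix.of fun i j =>
    match i, j with
    | .inl μ, .inl ν =>
        ((if μ = ν then 1 else 0) - (p μ : ℂ) * (p ν : ℂ) / nsq p) / nsq p
          - (α : ℂ) * (p μ : ℂ) * (p ν : ℂ) / (nsq p) ^ 2
    | .inl μ, .inr (.inl ν) => -(curlE p μ ν) / nsq p
    | .inl μ, .inr (.inr _) => Complex.I * (p μ : ℂ) / nsq p
    | .inr (.inl μ), .inl ν => -(curlE p μ ν) / nsq p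
    | .inr (.inl μ), .inr (.inl ν) => (p μ : ℂ) * (p ν : ℂ) / nsq p
    | .inr (.inl _), .inr (.inr _) => 0
    | .inr (.inr _), .inl ν => -Complex.I * (p ν : ℂ) / nsq p
    | .inr (.inr _), .inr (.inl _) => 0
    | .inr (.inr _), .inr (.inr _) => 0

theorem curlE_eq (p : EuclideanSpace ℝ (Fin 3)) :
    curlE p = !![0, -(p 2 : ℂ), (p 1 : ℂ); (p 2 : ℂ), 0, -(p 0 : ℂ);
      -(p 1 : ℂ), (p 0 : ℂ), 0] := by
  ext i j
  fin_cases i <;> fin_cases j <;> simp [curlE, eps, Fin.sum_univ_three]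

set_option maxHeartbeats 4000000 in
theorem Kgauss_mul_DeltaGauss (p : EuclideanSpace ℝ (Fin 3)) (hp : p ≠ 0) (α : ℝ) :
    Kgauss α p * DeltaGauss α p = 1 := by
  have hn : nsq p ≠ 0 := by
    simp [nsq, hp]
  have hs : nsq p = (p 0 : ℂ) ^ 2 + (p 1 : ℂ) ^ 2 + (p 2 : ℂ) ^ 2 := by
    have h := EuclideanSpace.norm_sq_eq p
    simp only [Fin.sum_univ_three, Real.norm_eq_abs, sq_abs] at h
    unfold nsq
    exact_mod_cast h
  have hI := Complex.I_sq
  ext i j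
  rw [Matrix.mul_apply]
  simp only [Fintype.sum_sum_type, Fin.sum_univ_three, Kgauss, DeltaGauss, curlE_eq,
    Matrix.of_apply, Finset.univ_unique, Finset.sum_singleton]
  rcases i with i | i | i <;> rcases j with j | j | j <;>
    (try fin_cases i) <;> (try fin_cases j) <;>
    simp <;> field_simp <;> (try simp only [hI]) <;> (try rw [hs]) <;> ring

/-- Inversion of the kinetic operator of the gaussian BFYM model: for every `p ≠ 0`
and every gauge parameter `α`, the propagator matrix `Δ(p)` is a two-sided inverse of
the kinetic matrix `K(p)`; in particular `K(p)` is invertible with inverse `Δ(p)`. -/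
theorem gaussian_BFYM_propagator_inverts_kinetic
    (p : EuclideanSpace ℝ (Fin 3)) (hp : p ≠ 0) (α : ℝ) :
    DeltaGauss α p * Kgauss α p = 1 ∧
    Kgauss α p * DeltaGauss α p = 1 ∧
    IsUnit (Kgauss α p) ∧
    (Kgauss α p)⁻¹ = DeltaGauss α p := by
  have h1 := Kgauss_mul_DeltaGauss p hp α
  have h2 : DeltaGauss α p * Kgauss α p = 1 := mul_eq_one_comm.mp h1
  exact ⟨h2, h1, IsUnit.of_mul_eq_one _ h1, Matrix.inv_eq_right_inv h1⟩
end
end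

section
/- Transversality of the B-sector propagators of the extended BFYM model in the Landau gauge: for every p ∈ ℝ³ with p ≠ 0, setting α = β = 0 in the extended propagator matrix Δ_ext(p), the blocks become Δ_AA(p) = P(p)/‖p‖², Δ_AB(p) = Δ_BA(p) = −E(p)/‖p‖², Δ_BB(p) = 0, Δ_Bη(p) = 0, and Δ_ηη(p) = 1/‖p‖², and every propagator carrying a B or A vector index is transverse: pᵀ·Δ_AA(p) = 0, pᵀ·Δ_AB(p) = 0, Δ_AB(p)·p = 0, and pᵀ·Δ_BB(p) = 0. Hence, in contrast with the gaussian model where the naive Δ_BB(p) = p pᵀ/‖p‖² fails transversality, in the extended formulation the tree-level propagators satisfy the Ward identity p_μ Δ_{B_μ B_ν}(p) = 0. -/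
open Matrix

noncomputable section

/-- The matrix `p pᵀ`, with entries `p μ * p ν`. -/
def ppT (p : EuclideanSpace ℝ (Fin 3)) : Matrix (Fin 3) (Fin 3) ℂ :=
  Matrix.of fun μ ν => (p μ : ℂ) * (p ν : ℂ)

/-- The transverse projector `P(p) = I₃ − p pᵀ/‖p‖²`. -/
def projT (p : EuclideanSpace ℝ (Fin 3)) : Matrix (Fin 3) (Fin 3) ℂ :=
  (1 : Matrix (Fin 3) (Fin 3) ℂ) - (nsq p)⁻¹ • ppT p

/-- `p` as a complex vector. -/
def pc (p : EuclideanSpace ℝ (Fin 3)) : Fin 3 → ℂ := fun ρ => (p ρ : ℂ)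

/-- The index type of the extended BFYM multiplet `(A ∈ ℂ³, B ∈ ℂ³, η ∈ ℂ, b ∈ ℂ, h ∈ ℂ)`. -/
abbrev ExtIdx : Type := Fin 3 ⊕ Fin 3 ⊕ Unit ⊕ Unit ⊕ Unit

/-- The extended BFYM propagator matrix `Δ_ext(p)`, with blocks
`[[P(p)/‖p‖² − α·p pᵀ/‖p‖⁴, −E(p)/‖p‖², 0, i·p/‖p‖², 0],
  [−E(p)/‖p‖², −β·p pᵀ/‖p‖⁴, −iβ·p/‖p‖⁴, 0, i·p/‖p‖²],
  [0, iβ·pᵀ/‖p‖⁴, 1/‖p‖² − β/‖p‖⁴, 0, 1/‖p‖²],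
  [−i·pᵀ/‖p‖², 0, 0, 0, 0],
  [0, −i·pᵀ/‖p‖², 1/‖p‖², 0, 0]]`. -/
def DeltaExt (α β : ℝ) (p : EuclideanSpace ℝ (Fin 3)) : Matrix ExtIdx ExtIdx ℂ :=
  Matrix.of fun i j =>
    match i, j with
    -- row A
    | .inl μ, .inl ν =>
        ((if μ = ν then 1 else 0) - (p μ : ℂ) * (p ν : ℂ) / nsq p) / nsq p
          - (α : ℂ) * (p μ : ℂ) * (p ν : ℂ) / (nsq p) ^ 2
    | .inl μ, .inr (.inl ν) => -(curlE p μ ν) / nsq p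
    | .inl _, .inr (.inr (.inl _)) => 0
    | .inl μ, .inr (.inr (.inr (.inl _))) => Complex.I * (p μ : ℂ) / nsq p
    | .inl _, .inr (.inr (.inr (.inr _))) => 0
    -- row B
    | .inr (.inl μ), .inl ν => -(curlE p μ ν) / nsq p
    | .inr (.inl μ), .inr (.inl ν) => -(β : ℂ) * (p μ : ℂ) * (p ν : ℂ) / (nsq p) ^ 2
    | .inr (.inl μ), .inr (.inr (.inl _)) => -Complex.I * (β : ℂ) * (p μ : ℂ) / (nsq p) ^ 2
    | .inr (.inl _), .inr (.inr (.inr (.inl _))) => 0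
    | .inr (.inl μ), .inr (.inr (.inr (.inr _))) => Complex.I * (p μ : ℂ) / nsq p
    -- row η
    | .inr (.inr (.inl _)), .inl _ => 0
    | .inr (.inr (.inl _)), .inr (.inl ν) => Complex.I * (β : ℂ) * (p ν : ℂ) / (nsq p) ^ 2
    | .inr (.inr (.inl _)), .inr (.inr (.inl _)) => 1 / nsq p - (β : ℂ) / (nsq p) ^ 2
    | .inr (.inr (.inl _)), .inr (.inr (.inr (.inl _))) => 0
    | .inr (.inr (.inl _)), .inr (.inr (.inr (.inr _))) => 1 / nsq p
    -- row b
    | .inr (.inr (.inr (.inl _))), .inl ν => -Complex.I * (p ν : ℂ) / nsq p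
    | .inr (.inr (.inr (.inl _))), .inr _ => 0
    -- row h
    | .inr (.inr (.inr (.inr _))), .inl _ => 0
    | .inr (.inr (.inr (.inr _))), .inr (.inl ν) => -Complex.I * (p ν : ℂ) / nsq p
    | .inr (.inr (.inr (.inr _))), .inr (.inr (.inl _)) => 1 / nsq p
    | .inr (.inr (.inr (.inr _))), .inr (.inr (.inr _)) => 0

/-- The `(A,A)` block of an extended propagator matrix. -/
def blockAA (M : Matrix ExtIdx ExtIdx ℂ) : Matrix (Fin 3) (Fin 3) ℂ :=
  Matrix.of fun μ ν => M (.inl μ) (.inl ν)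

/-- The `(A,B)` block of an extended propagator matrix. -/
def blockAB (M : Matrix ExtIdx ExtIdx ℂ) : Matrix (Fin 3) (Fin 3) ℂ :=
  Matrix.of fun μ ν => M (.inl μ) (.inr (.inl ν))

/-- The `(B,A)` block of an extended propagator matrix. -/
def blockBA (M : Matrix ExtIdx ExtIdx ℂ) : Matrix (Fin 3) (Fin 3) ℂ :=
  Matrix.of fun μ ν => M (.inr (.inl μ)) (.inl ν)

/-- The `(B,B)` block of an extended propagator matrix. -/
def blockBB (M : Matrix ExtIdx ExtIdx ℂ) : Matrix (Fin 3) (Fin 3) ℂ :=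
  Matrix.of fun μ ν => M (.inr (.inl μ)) (.inr (.inl ν))

/-- The `(B,η)` block of an extended propagator matrix. -/
def blockBeta (M : Matrix ExtIdx ExtIdx ℂ) : Fin 3 → ℂ :=
  fun μ => M (.inr (.inl μ)) (.inr (.inr (.inl ())))

/-- The `(η,η)` block of an extended propagator matrix. -/
def blockEtaEta (M : Matrix ExtIdx ExtIdx ℂ) : ℂ :=
  M (.inr (.inr (.inl ()))) (.inr (.inr (.inl ())))

/-- Transversality of the B-sector propagators of the extended BFYM model in the Landau
gauge `α = β = 0`: the blocks of `Δ_ext(p)` become `Δ_AA = P(p)/‖p‖²`,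
`Δ_AB = Δ_BA = −E(p)/‖p‖²`, `Δ_BB = 0`, `Δ_Bη = 0`, `Δ_ηη = 1/‖p‖²`, and every
propagator carrying a `B` or `A` vector index is transverse; in particular the
tree-level Ward identity `p_μ Δ_{B_μ B_ν}(p) = 0` holds. -/
theorem extended_BFYM_landau_transversality (p : EuclideanSpace ℝ (Fin 3)) (hp : p ≠ 0) :
    blockAA (DeltaExt 0 0 p) = (nsq p)⁻¹ • projT p ∧
    blockAB (DeltaExt 0 0 p) = -((nsq p)⁻¹ • curlE p) ∧
    blockBA (DeltaExt 0 0 p) = -((nsq p)⁻¹ • curlE p) ∧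
    blockBB (DeltaExt 0 0 p) = 0 ∧
    blockBeta (DeltaExt 0 0 p) = 0 ∧
    blockEtaEta (DeltaExt 0 0 p) = (nsq p)⁻¹ ∧
    Matrix.vecMul (pc p) (blockAA (DeltaExt 0 0 p)) = 0 ∧
    Matrix.vecMul (pc p) (blockAB (DeltaExt 0 0 p)) = 0 ∧
    blockAB (DeltaExt 0 0 p) *ᵥ pc p = 0 ∧
    Matrix.vecMul (pc p) (blockBB (DeltaExt 0 0 p)) = 0 := by
  have hn : nsq p ≠ 0 := by
    simp [nsq, hp]
  have hs : nsq p = (p 0 : ℂ) ^ 2 + (p 1 : ℂ) ^ 2 + (p 2 : ℂ) ^ 2 := by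
    have h := EuclideanSpace.real_norm_sq_eq p
    rw [Fin.sum_univ_three] at h
    unfold nsq
    exact_mod_cast h
  have hAA : blockAA (DeltaExt 0 0 p) = (nsq p)⁻¹ • projT p := by
    ext μ ν
    simp [blockAA, DeltaExt, projT, ppT, Matrix.one_apply]
    ring
  have hAB : blockAB (DeltaExt 0 0 p) = -((nsq p)⁻¹ • curlE p) := by
    ext μ ν
    simp [blockAB, DeltaExt]
    ring
  have hBA : blockBA (DeltaExt 0 0 p) = -((nsq p)⁻¹ • curlE p) := by
    ext μ ν
    simp [blockBA, DeltaExt]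
    ring
  have hBB : blockBB (DeltaExt 0 0 p) = 0 := by
    ext μ ν
    simp [blockBB, DeltaExt]
  have hP : Matrix.vecMul (pc p) (projT p) = 0 := by
    have h1 : Matrix.vecMul (pc p) (ppT p) = nsq p • pc p := by
      ext ν
      simp only [Matrix.vecMul, dotProduct, Fin.sum_univ_three, pc, ppT, Matrix.of_apply,
        Pi.smul_apply, smul_eq_mul, hs]
      ring
    rw [projT, Matrix.vecMul_sub, Matrix.vecMul_one, Matrix.vecMul_smul, h1, smul_smul,
      inv_mul_cancel₀ hn, one_smul, sub_self]
  have hE1 : Matrix.vecMul (pc p) (curlE p) = 0 := by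
    ext ν
    fin_cases ν <;>
      simp [Matrix.vecMul, dotProduct, Fin.sum_univ_three, pc, curlE, eps] <;> ring
  have hE2 : curlE p *ᵥ pc p = 0 := by
    ext ν
    fin_cases ν <;>
      simp [Matrix.mulVec, dotProduct, Fin.sum_univ_three, pc, curlE, eps] <;> ring
  refine ⟨hAA, hAB, hBA, hBB, ?_, ?_, ?_, ?_, ?_, ?_⟩
  · ext μ
    simp [blockBeta, DeltaExt]
  · simp [blockEtaEta, DeltaExt]
  · rw [hAA, Matrix.vecMul_smul, hP, smul_zero]
  · rw [hAB, Matrix.vecMul_neg, Matrix.vecMul_smul, hE1, smul_zero, neg_zero]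
  · rw [hAB, Matrix.neg_mulVec, Matrix.smul_mulVec, hE2, smul_zero, neg_zero]
  · rw [hBB, Matrix.vecMul_zero]
end
end
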